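/- arXiv:2104.14997 — 2 statements merged into one kernel-verified Lean document; each statement's English description precedes it below -/
import Mathlib

section
/- Let Z be a real reflexive Banach space continuously and densely embedded in a real reflexive Banach space V, τ > 0, and let R : Z → [0,∞] be proper, convex, lower semicontinuous and positively 1-homogeneous. Let I_τ be the indicator functional of {v ∈ Z : ‖v‖_V ≤ τ}. Suppose ξ ∈ Z* and w ∈ Z satisfy the stationarity inclusion 0 ∈ ∂(R + I_τ)(w) + ξ. Then there exists ζ ∈ V* (viewed as an element of Z*) with ζ ∈ ∂I_τ(w) such that: (i) ‖ζ‖_{V*}·(‖w‖_V − τ) = 0; (ii) τ·dist_{V*}(−ξ, ∂R(0)) = ⟨ζ, w⟩; (iii) R(w) + τ·dist_{V*}(−ξ, ∂R(0)) = ⟨−ξ, w⟩; and (iv) R(v) ≥ −⟨ζ + ξ, v⟩ for all v ∈ Z. -/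
open Set Filter

variable {Z V : Type*} [NormedAddCommGroup Z] [NormedSpace ℝ Z]
  [NormedAddCommGroup V] [NormedSpace ℝ V]

/-- `η ∈ Z*` is bounded with respect to the `V`-norm on `Z` (i.e. `η` belongs to `V*`,
identified with a subspace of `Z*` via the dense embedding `ι : Z ↪ V`). -/
def InVdual (ι : Z →L[ℝ] V) (η : Z →L[ℝ] ℝ) : Prop :=
  ∃ C : ℝ, ∀ z : Z, |η z| ≤ C * ‖ι z‖

/-- The `V*`-norm of `η ∈ Z*`: `‖η‖_{V*} = sup{⟨η, v⟩ : v ∈ Z, ‖v‖_V ≤ 1}`. -/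
noncomputable def VdualNorm (ι : Z →L[ℝ] V) (η : Z →L[ℝ] ℝ) : ℝ :=
  sSup {r : ℝ | ∃ z : Z, ‖ι z‖ ≤ 1 ∧ r = η z}

/-- The extended distance `dist_{V*}(η, A) = inf{‖η − w‖_{V*} : w ∈ A, η − w ∈ V*}`,
interpreted as `+∞` (in `EReal`) if no such `w` exists. -/
noncomputable def distVdual (ι : Z →L[ℝ] V) (η : Z →L[ℝ] ℝ) (A : Set (Z →L[ℝ] ℝ)) : EReal :=
  sInf {r : EReal | ∃ w ∈ A, InVdual ι (η - w) ∧ r = ((VdualNorm ι (η - w) : ℝ) : EReal)}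

/-- The indicator functional `I_τ` of `{v ∈ Z : ‖v‖_V ≤ τ}`, with values in `EReal`. -/
noncomputable def indic (ι : Z →L[ℝ] V) (τ : ℝ) (v : Z) : EReal :=
  if ‖ι v‖ ≤ τ then 0 else ⊤

/-- The subdifferential of an extended-real-valued convex functional `f : Z → EReal` at `x`:
`∂f(x) = {η ∈ Z* : f(y) ≥ f(x) + ⟨η, y − x⟩ for all y ∈ Z}`. -/
def subdiffE (f : Z → EReal) (x : Z) : Set (Z →L[ℝ] ℝ) :=
  {η | ∀ y : Z, f x + ((η (y - x) : ℝ) : EReal) ≤ f y}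

/-- The Fenchel conjugate `f*(η) = sup_{x ∈ Z} (⟨η, x⟩ − f(x))`, with values in `EReal`. -/
noncomputable def conjE (f : Z → EReal) (η : Z →L[ℝ] ℝ) : EReal :=
  ⨆ x : Z, ((η x : ℝ) : EReal) - f x

/-- Sandwich theorem: a positively homogeneous subadditive function `g` on a convex cone `D`
that dominates `-p` for a seminorm `p` admits a linear `f` with `f ≤ p` and `-f ≤ g` on `D`. -/
theorem exists_linearMap_between_seminorm {E : Type*} [AddCommGroup E] [Module ℝ E]
    (p : Seminorm ℝ E) (D : Set E) (g : E → ℝ) (h0 : (0 : E) ∈ D) (hg0 : g 0 = 0)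
    (hadd : ∀ x ∈ D, ∀ y ∈ D, x + y ∈ D ∧ g (x + y) ≤ g x + g y)
    (hsmul : ∀ c : ℝ, 0 < c → ∀ x ∈ D, c • x ∈ D ∧ g (c • x) = c * g x)
    (hlow : ∀ x ∈ D, -p x ≤ g x) :
    ∃ f : E →ₗ[ℝ] ℝ, (∀ x, f x ≤ p x) ∧ ∀ x ∈ D, -f x ≤ g x := by
  have : Nonempty D := ⟨⟨0, h0⟩⟩
  let N : E → ℝ := fun v => ⨅ u : D, (p (v + u) + g u)
  have hbdd : ∀ v, BddBelow (range fun u : D => p (v + u) + g u) := by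
    refine fun v => ⟨-p v, ?_⟩
    rintro _ ⟨⟨u, hu⟩, rfl⟩
    have h1 := hlow u hu
    have h2 : p u ≤ p (v + u) + p v := by
      simpa using map_sub_le_add p (v + u) v
    dsimp only
    linarith
  have hN_le : ∀ v, ∀ u ∈ D, N v ≤ p (v + u) + g u := fun v u hu =>
    ciInf_le (hbdd v) (⟨u, hu⟩ : D)
  have hN_smul_le : ∀ c : ℝ, 0 < c → ∀ x, N (c • x) ≤ c * N x := by
    intro c hc x
    rw [← div_le_iff₀' hc]
    refine le_ciInf fun ⟨u, hu⟩ => ?_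
    rw [div_le_iff₀' hc]
    obtain ⟨h1, h2⟩ := hsmul c hc u hu
    refine (hN_le _ _ h1).trans_eq ?_
    rw [h2, ← smul_add, map_smul_eq_mul, Real.norm_of_nonneg hc.le]
    ring
  have hN_smul : ∀ c : ℝ, 0 < c → ∀ x, N (c • x) = c * N x := by
    refine fun c hc x => (hN_smul_le c hc x).antisymm ?_
    have h := hN_smul_le c⁻¹ (inv_pos.2 hc) (c • x)
    rwa [inv_smul_smul₀ hc.ne', inv_mul_eq_div, le_div_iff₀' hc] at h
  have hN_add : ∀ x y, N (x + y) ≤ N x + N y := by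
    intro x y
    refine le_ciInf_add_ciInf fun ⟨u, hu⟩ ⟨v, hv⟩ => ?_
    obtain ⟨h1, h2⟩ := hadd u hu v hv
    have h3 := hN_le (x + y) _ h1
    have h4 : p (x + y + (u + v)) ≤ p (x + u) + p (y + v) := by
      rw [add_add_add_comm]
      exact map_add_le_add p _ _
    dsimp only
    linarith
  have hN_zero : N 0 = 0 := by
    have h := hN_smul 2 two_pos 0
    rw [smul_zero] at h
    linarith
  obtain ⟨f, -, hf⟩ := exists_extension_of_le_sublinear (⊥ : E →ₗ.[ℝ] ℝ) N hN_smul hN_add (by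
    rintro ⟨x, hx⟩
    obtain rfl : x = 0 := (Submodule.mem_bot ℝ).1 hx
    exact (LinearPMap.map_zero _).trans_le hN_zero.ge)
  refine ⟨f, fun x => (hf x).trans ?_, fun x hx => ?_⟩
  · simpa [hg0] using hN_le x 0 h0
  · have h := (hf (-x)).trans (hN_le (-x) x hx)
    simpa using h

theorem apply_le_VdualNorm_mul {ι : Z →L[ℝ] V} {η : Z →L[ℝ] ℝ} (hη : InVdual ι η) {τ : ℝ}
    (hτ : 0 < τ) {z : Z} (hz : ‖ι z‖ ≤ τ) : η z ≤ τ * VdualNorm ι η := by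
  obtain ⟨C, hC⟩ := hη
  have hbdd : BddAbove {r : ℝ | ∃ z : Z, ‖ι z‖ ≤ 1 ∧ r = η z} := by
    refine ⟨|C|, ?_⟩
    rintro _ ⟨y, hy, rfl⟩
    calc η y ≤ C * ‖ι y‖ := (le_abs_self _).trans (hC y)
      _ ≤ |C| * 1 := mul_le_mul (le_abs_self C) hy (norm_nonneg _) (abs_nonneg C)
      _ = |C| := mul_one _
  have h : τ⁻¹ * η z ≤ VdualNorm ι η := by
    refine le_csSup hbdd ⟨τ⁻¹ • z, ?_, by simp⟩
    rw [map_smul, norm_smul, Real.norm_of_nonneg (inv_pos.2 hτ).le, inv_mul_eq_div]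
    exact (div_le_one hτ).2 hz
  rwa [inv_mul_eq_div, div_le_iff₀' hτ] at h

theorem VdualNorm_le {ι : Z →L[ℝ] V} {η : Z →L[ℝ] ℝ} {C : ℝ} (hC0 : 0 ≤ C)
    (hC : ∀ z, η z ≤ C * ‖ι z‖) : VdualNorm ι η ≤ C := by
  refine csSup_le ⟨0, 0, by simp, by simp⟩ ?_
  rintro _ ⟨z, hz, rfl⟩
  exact (hC z).trans (mul_le_of_le_one_right hC0 hz)

/-- A proper, nonnegative, lower semicontinuous, positively homogeneous functional vanishes at
the origin. -/
theorem map_zero_of_lsc_of_posHom {R : Z → EReal} (hR0 : ∀ v, 0 ≤ R v)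
    (hRproper : ∃ v, R v ≠ ⊤) (hRlsc : LowerSemicontinuous R)
    (hRhom : ∀ (v : Z) (l : ℝ), 0 < l → R (l • v) = (l : EReal) * R v) : R 0 = 0 := by
  obtain ⟨v, hv⟩ := hRproper
  refine le_antisymm (not_lt.1 fun hlt => ?_) (hR0 0)
  obtain ⟨c, hc0, hc⟩ := EReal.lt_iff_exists_real_btwn.1 hlt
  have hc0' : 0 < c := by exact_mod_cast hc0
  have hcont : Tendsto (fun l : ℝ => l • v) (nhdsWithin 0 (Ioi 0)) (nhds 0) := by
    have : Continuous fun l : ℝ => l • v := by fun_prop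
    simpa using (this.tendsto 0).mono_left nhdsWithin_le_nhds
  have hr : Tendsto (fun l : ℝ => l * (R v).toReal) (nhdsWithin 0 (Ioi 0)) (nhds 0) := by
    have : Continuous fun l : ℝ => l * (R v).toReal := by fun_prop
    simpa using (this.tendsto 0).mono_left nhdsWithin_le_nhds
  obtain ⟨l, ⟨h1, h2⟩, hl⟩ := ((hcont.eventually (hRlsc 0 c hc)).and
    (hr.eventually (gt_mem_nhds hc0'))).and self_mem_nhdsWithin |>.exists
  rw [hRhom v l hl, ← EReal.coe_toReal hv ((EReal.bot_lt_zero.trans_le (hR0 v)).ne')] at h1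
  exact absurd h2 (not_lt.2 (le_of_lt (by exact_mod_cast h1)))

/-- **Discrete optimality system.** Let `Z` be a real reflexive Banach space continuously and
densely embedded in a real reflexive Banach space `V` (via `ι`), `τ > 0`, and let
`R : Z → [0,∞]` be proper, convex, lower semicontinuous and positively 1-homogeneous.
Suppose `ξ ∈ Z*` and `w ∈ Z` satisfy the stationarity inclusion
`0 ∈ ∂(R + I_τ)(w) + ξ`. Then there exists `ζ ∈ V*` (viewed in `Z*`) with `ζ ∈ ∂I_τ(w)`
such that (i) `‖ζ‖_{V*}·(‖w‖_V − τ) = 0`; (ii) `τ·dist_{V*}(−ξ, ∂R(0)) = ⟨ζ, w⟩`;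
(iii) `R(w) + τ·dist_{V*}(−ξ, ∂R(0)) = ⟨−ξ, w⟩`; (iv) `R(v) ≥ −⟨ζ + ξ, v⟩` for all `v ∈ Z`. -/
theorem stmt11 [CompleteSpace Z] [CompleteSpace V]
    (hreflZ : Function.Surjective ⇑(NormedSpace.inclusionInDoubleDual ℝ Z))
    (hreflV : Function.Surjective ⇑(NormedSpace.inclusionInDoubleDual ℝ V))
    (ι : Z →L[ℝ] V) (hinj : Function.Injective ι) (hdense : DenseRange ι)
    (τ : ℝ) (hτ : 0 < τ)
    (R : Z → EReal) (hR0 : ∀ v : Z, 0 ≤ R v) (hRproper : ∃ v : Z, R v ≠ ⊤)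
    (hRconvex : ∀ x y : Z, ∀ a b : ℝ, 0 ≤ a → 0 ≤ b → a + b = 1 →
      R (a • x + b • y) ≤ (a : EReal) * R x + (b : EReal) * R y)
    (hRlsc : LowerSemicontinuous R)
    (hRhom : ∀ (v : Z) (l : ℝ), 0 < l → R (l • v) = (l : EReal) * R v)
    (ξ : Z →L[ℝ] ℝ) (w : Z)
    (hstat : -ξ ∈ subdiffE (fun v => R v + indic ι τ v) w) :
    ∃ ζ : Z →L[ℝ] ℝ, InVdual ι ζ ∧ ζ ∈ subdiffE (indic ι τ) w ∧
      VdualNorm ι ζ * (‖ι w‖ - τ) = 0 ∧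
      (τ : EReal) * distVdual ι (-ξ) (subdiffE R 0) = ((ζ w : ℝ) : EReal) ∧
      R w + (τ : EReal) * distVdual ι (-ξ) (subdiffE R 0) = ((-(ξ w) : ℝ) : EReal) ∧
      ∀ v : Z, ((-(ζ v + ξ v) : ℝ) : EReal) ≤ R v := by
  have hRz : R 0 = 0 := map_zero_of_lsc_of_posHom hR0 hRproper hRlsc hRhom
  have hcoe : ∀ v, R v ≠ ⊤ → ((R v).toReal : EReal) = R v := fun v hv =>
    EReal.coe_toReal hv (EReal.bot_lt_zero.trans_le (hR0 v)).ne'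
  have hw0 := hstat 0
  have hind0 : indic ι τ 0 = 0 := by simp [indic, hτ.le]
  have hwτ : ‖ι w‖ ≤ τ := by
    by_contra h
    simp [indic, h, hRz, hτ.le, EReal.add_top_of_ne_bot
      (EReal.bot_lt_zero.trans_le (hR0 w)).ne'] at hw0
  have hindw : indic ι τ w = 0 := if_pos hwτ
  have hRw : R w ≠ ⊤ := by
    intro h
    simp [hindw, h, hRz, hind0] at hw0
  have hmin : ∀ v, R v ≠ ⊤ → ‖ι v‖ ≤ τ →
      (R w).toReal + ξ w ≤ (R v).toReal + ξ v := by
    intro v hv hvτ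
    have h := hstat v
    simp only [hindw, show indic ι τ v = 0 from if_pos hvτ, add_zero] at h
    rw [← hcoe v hv, ← hcoe w hRw] at h
    have h' : (R w).toReal + (-ξ) (v - w) ≤ (R v).toReal := by exact_mod_cast h
    simp only [neg_apply, map_sub] at h'
    linarith
  obtain ⟨m, hm⟩ : ∃ m : ℝ, m = -((R w).toReal + ξ w) := ⟨_, rfl⟩
  have hm0 : 0 ≤ m := by
    have h := hmin 0 (by simp [hRz]) (by simp [hτ.le])
    simp only [hRz, EReal.toReal_zero, map_zero] at h
    linarith
  have hsmul : ∀ c : ℝ, 0 < c → ∀ x, R x ≠ ⊤ →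
      R (c • x) ≠ ⊤ ∧ (R (c • x)).toReal = c * (R x).toReal := by
    intro c hc x hx
    have h : R (c • x) = ((c * (R x).toReal : ℝ) : EReal) := by
      rw [hRhom x c hc, EReal.coe_mul, hcoe x hx]
    rw [h]
    exact ⟨EReal.coe_ne_top _, EReal.toReal_coe _⟩
  have hadd : ∀ x, R x ≠ ⊤ → ∀ y, R y ≠ ⊤ →
      R (x + y) ≠ ⊤ ∧ (R (x + y)).toReal ≤ (R x).toReal + (R y).toReal := by
    intro x hx y hy
    have h := hRconvex x y (1 / 2) (1 / 2) (by norm_num) (by norm_num) (by norm_num)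
    rw [← hcoe x hx, ← hcoe y hy, ← EReal.coe_mul, ← EReal.coe_mul, ← EReal.coe_add,
      ← smul_add] at h
    have hne : R ((1 / 2 : ℝ) • (x + y)) ≠ ⊤ := ne_top_of_le_ne_top (EReal.coe_ne_top _) h
    rw [← hcoe _ hne, EReal.coe_le_coe_iff] at h
    obtain ⟨h1, h2⟩ := hsmul 2 two_pos _ hne
    rw [smul_smul, show (2 : ℝ) * (1 / 2) = 1 by norm_num, one_smul] at h1 h2
    exact ⟨h1, by linarith⟩
  let c : NNReal := ⟨m / τ, div_nonneg hm0 hτ.le⟩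
  let p : Seminorm ℝ Z := c •
    (normSeminorm ℝ V).comp (ι : Z →ₗ[ℝ] V)
  have hp : ∀ z, p z = m / τ * ‖ι z‖ := fun z => rfl
  obtain ⟨f, hfp, hfR⟩ := exists_linearMap_between_seminorm p {v | R v ≠ ⊤}
    (fun v => (R v).toReal + ξ v) (by simp [hRz]) (by simp [hRz])
    (fun x hx y hy => ⟨(hadd x hx y hy).1, by
      have := (hadd x hx y hy).2
      simp only [map_add]
      linarith⟩)
    (fun c hc x hx => ⟨(hsmul c hc x hx).1, by
      simp only [(hsmul c hc x hx).2, map_smul, smul_eq_mul]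
      ring⟩)
    (fun x hx => by
      rw [hp]
      rcases eq_or_ne x 0 with rfl | hx0
      · simp [hRz]
      have hpos : 0 < ‖ι x‖ := norm_pos_iff.2 ((map_ne_zero_iff ι hinj).2 hx0)
      have hc : 0 < τ / ‖ι x‖ := by positivity
      obtain ⟨h1, h2⟩ := hsmul _ hc x hx
      have h := hmin _ h1 (by
        rw [map_smul, norm_smul, Real.norm_of_nonneg hc.le, div_mul_cancel₀ _ hpos.ne'])
      rw [h2, map_smul, smul_eq_mul, ← mul_add] at h
      have h3 : -m ≤ τ / ‖ι x‖ * ((R x).toReal + ξ x) := by linarith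
      rw [div_mul_eq_mul_div, le_div_iff₀ hpos] at h3
      rw [div_mul_eq_mul_div, ← neg_div, div_le_iff₀ hτ]
      linarith)
  have hfabs : ∀ z, |f z| ≤ m / τ * ‖ι z‖ := by
    intro z
    rw [abs_le]
    have h1 := hfp z
    have h2 := hfp (-z)
    rw [map_neg, map_neg_eq_map] at h2
    rw [hp] at h1 h2
    exact ⟨by linarith, h1⟩
  let ζ : Z →L[ℝ] ℝ := f.mkContinuous (m / τ * ‖ι‖) fun z => by
    rw [Real.norm_eq_abs, mul_assoc]
    exact (hfabs z).trans (mul_le_mul_of_nonneg_left (ι.le_opNorm z) (by positivity))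
  have hζabs : ∀ z, |ζ z| ≤ m / τ * ‖ι z‖ := hfabs
  have hζR : ∀ v, R v ≠ ⊤ → -ζ v ≤ (R v).toReal + ξ v := hfR
  have hζV : InVdual ι ζ := ⟨_, hζabs⟩
  have hζle : ∀ v, ‖ι v‖ ≤ τ → ζ v ≤ m := fun v hv =>
    calc ζ v ≤ m / τ * ‖ι v‖ := (le_abs_self _).trans (hζabs v)
      _ ≤ m / τ * τ := mul_le_mul_of_nonneg_left hv (by positivity)
      _ = m := div_mul_cancel₀ _ hτ.ne'
  have hζw : ζ w = m := (hζle w hwτ).antisymm (by linarith [hζR w hRw])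
  have hnorm_le : VdualNorm ι ζ ≤ m / τ :=
    VdualNorm_le (by positivity) fun z => (le_abs_self _).trans (hζabs z)
  have hnorm : VdualNorm ι ζ = m / τ := by
    refine hnorm_le.antisymm ?_
    rw [div_le_iff₀' hτ, ← hζw]
    exact apply_le_VdualNorm_mul hζV hτ hwτ
  have hiv : ∀ v : Z, ((-(ζ v + ξ v) : ℝ) : EReal) ≤ R v := by
    intro v
    by_cases hv : R v = ⊤
    · simp [hv]
    · rw [← hcoe v hv, EReal.coe_le_coe_iff]
      linarith [hζR v hv]
  have hdist : distVdual ι (-ξ) (subdiffE R 0) = ((m / τ : ℝ) : EReal) := by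
    apply le_antisymm
    · refine sInf_le ⟨-ξ - ζ, fun v => ?_, ?_, ?_⟩
      · rw [hRz, zero_add, sub_zero]
        refine le_of_eq_of_le ?_ (hiv v)
        congr 1
        simp only [sub_apply, neg_apply]
        ring
      · rwa [sub_sub_cancel]
      · rw [sub_sub_cancel, hnorm]
    · refine le_sInf ?_
      rintro _ ⟨η, hη, hηV, rfl⟩
      rw [EReal.coe_le_coe_iff, div_le_iff₀' hτ]
      refine le_trans ?_ (apply_le_VdualNorm_mul hηV hτ hwτ)
      have h := hη w
      rw [hRz, zero_add, sub_zero, ← hcoe w hRw, EReal.coe_le_coe_iff] at h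
      simp only [sub_apply, neg_apply]
      linarith
  have hdist_mul : (τ : EReal) * distVdual ι (-ξ) (subdiffE R 0) = (m : EReal) := by
    rw [hdist, ← EReal.coe_mul, mul_div_cancel₀ _ hτ.ne']
  refine ⟨ζ, hζV, fun v => ?_, ?_, ?_, ?_, hiv⟩
  · by_cases hv : ‖ι v‖ ≤ τ
    · rw [hindw, show indic ι τ v = 0 from if_pos hv, zero_add, map_sub, hζw]
      exact_mod_cast sub_nonpos.2 (hζle v hv)
    · simp [indic, hv]
  · have h := (le_abs_self _).trans (hζabs w)
    rw [hζw] at h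
    have h1 : m / τ * (‖ι w‖ - τ) = m / τ * ‖ι w‖ - m := by
      rw [mul_sub, div_mul_cancel₀ _ hτ.ne']
    rw [hnorm]
    refine le_antisymm (mul_nonpos_of_nonneg_of_nonpos (by positivity) (by linarith)) ?_
    linarith
  · rw [hdist_mul, hζw]
  · rw [hdist_mul, ← hcoe w hRw, ← EReal.coe_add, hm]
    congr 1
    ring
end

section
/- Let Z, V, X be real Banach spaces with Z and V reflexive, Z separable, Z compactly and densely embedded in V, and V continuously embedded in X. Let T > 0, and let I : [0,T] × Z → ℝ satisfy: I ∈ C¹([0,T] × Z); I(t,z) ≥ c₁‖z‖_Z − c₀ with c₀, c₁ > 0; |∂_t I(t,z)| ≤ μ(t)(I(t,z) + β) with β > 0 and nonnegative μ ∈ L¹(0,T); the Gårding-like inequality ⟨D_zI(t,z₁) − D_zI(t,z₂), z₁ − z₂⟩ ≥ α‖z₁ − z₂‖_Z² − c(ρ)‖z₁ − z₂‖_V² (α > 0) for ‖z₁‖_Z, ‖z₂‖_Z ≤ ρ; and the time-Lipschitz estimate ⟨D_zI(t,z) − D_zI(s,z), v⟩ ≤ C(ρ)|t − s|·‖v‖_Z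 for ‖z‖_Z ≤ ρ. Let R : Z → [0,∞] be proper, convex, lower semicontinuous, positively 1-homogeneous, with κ‖v‖_X ≤ R(v) for some κ > 0. Let τ ∈ (0,T], let z₀ ∈ Z satisfy the initial stability −D_zI(0,z₀) ∈ ∂R(0), and let iterates be generated by: t₀ = 0; for k ≥ 1, z_k ∈ Z satisfies the stationarity inclusion 0 ∈ ∂(R + I_τ)(z_k − z_{k−1}) + D_zI(t_{k−1}, z_k) together with I(t_{k−1}, z_k) + R(z_k − z_{k−1}) ≤ I(t_{k−1}, z_{k−1}), and t_k = t_{k−1} + τ − ‖z_k − z_{k−1}‖_V. Then there exists a finite index N with t_N ≥ T, and there exist constants C₁, C₂, C₃ > 0, depending only on the above data (T, α, c(·), C(·), c₀, c₁, κ, β, μ, ‖z₀‖_Z, I(0,z₀)) but not on τ, such that Σ_{i=1}^{N} ‖z_i − z_{i−1}‖_V ≤ C₁, Σ_{i=1}^{N} ‖z_i − z_{i−1}‖_Z² ≤ C₂·τ, and dist_{V*}(−D_zI(t_{k−1}, z_k), ∂R(0)) ≤ C₃ for all k = 1, …, N. -/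
open Set Filter

variable {Z V : Type*} [NormedAddCommGroup Z] [NormedSpace ℝ Z]
  [NormedAddCommGroup V] [NormedSpace ℝ V]

/-- **Ehrling's inequality** for a compact embedding `ι` followed by an injective map `ιX`. -/
lemma ehrling {X : Type*} [NormedAddCommGroup X] [NormedSpace ℝ X] (ι : Z →L[ℝ] V)
    (hcompact : ∀ s : Set Z, Bornology.IsBounded s → IsCompact (closure (ι '' s)))
    (ιX : V →L[ℝ] X) (hinjX : Function.Injective ιX) {ε : ℝ} (hε : 0 < ε) :
    ∃ C : ℝ, 0 ≤ C ∧ ∀ z : Z, ‖ι z‖ ≤ ε * ‖z‖ + C * ‖ιX (ι z)‖ := by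
  obtain ⟨m, hm, hmin⟩ : ∃ m : ℝ, 0 < m ∧
      ∀ w ∈ closure (ι '' Metric.closedBall 0 ε⁻¹) ∩ Metric.sphere 0 1, m ≤ ‖ιX w‖ := by
    refine ((hcompact _ Metric.isBounded_closedBall).inter_right
      Metric.isClosed_sphere).exists_forall_le' (by fun_prop) fun w hw => ?_
    refine norm_pos_iff.2 fun h => ?_
    have hw0 : w = 0 := hinjX (by simpa using h)
    simp [hw0] at hw
  refine ⟨m⁻¹, (inv_pos.2 hm).le, fun z => ?_⟩
  rcases eq_or_ne (ι z) 0 with h0 | h0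
  · rw [h0]; simp; positivity
  have hpos : 0 < ‖ι z‖ := norm_pos_iff.2 h0
  rcases le_total ‖ι z‖ (ε * ‖z‖) with h | h
  · have : 0 ≤ m⁻¹ * ‖ιX (ι z)‖ := by positivity
    linarith
  have key := hmin (ι (‖ι z‖⁻¹ • z)) ⟨subset_closure ⟨_, ?_, rfl⟩, ?_⟩
  · rw [map_smul, map_smul, norm_smul, norm_inv, norm_norm, ← div_eq_inv_mul,
      le_div_iff₀ hpos] at key
    have : ‖ι z‖ ≤ m⁻¹ * ‖ιX (ι z)‖ := by
      rw [← div_eq_inv_mul, le_div_iff₀ hm]; linarith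
    have : 0 ≤ ε * ‖z‖ := by positivity
    linarith
  · rw [mem_closedBall_zero_iff, norm_smul, norm_inv, norm_norm, ← div_eq_inv_mul,
      div_le_iff₀ hpos, ← div_eq_inv_mul, le_div_iff₀ hε]
    linarith
  · rw [mem_sphere_zero_iff_norm, map_smul, norm_smul, norm_inv, norm_norm,
      inv_mul_cancel₀ hpos.ne']

/-- A Gronwall estimate with an integrable rate. -/
lemma le_mul_exp_integral {T : ℝ} {f f' μ : ℝ → ℝ}
    (hf : ∀ t ∈ Icc (0:ℝ) T, HasDerivWithinAt f (f' t) (Icc 0 T) t)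
    (hpos : ∀ t ∈ Icc (0:ℝ) T, 0 < f t)
    (hμint : MeasureTheory.IntegrableOn μ (Icc 0 T))
    (hle : ∀ t ∈ Icc (0:ℝ) T, f' t ≤ μ t * f t)
    {s t : ℝ} (hs : 0 ≤ s) (hst : s ≤ t) (htT : t ≤ T) :
    f t ≤ f s * Real.exp ((∫ x in (0:ℝ)..t, μ x) - ∫ x in (0:ℝ)..s, μ x) := by
  have hsub : Icc s t ⊆ Icc 0 T := Icc_subset_Icc hs htT
  have hii : ∀ r, 0 ≤ r → r ≤ T → IntervalIntegrable μ MeasureTheory.volume 0 r :=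
    fun r h0 hr => (intervalIntegrable_iff_integrableOn_Icc_of_le h0).2
      (hμint.mono_set (Icc_subset_Icc le_rfl hr))
  rw [intervalIntegral.integral_interval_sub_left (hii t (hs.trans hst) htT)
    (hii s hs (hst.trans htT))]
  have key := intervalIntegral.sub_le_integral_of_hasDeriv_right_of_le
    (g := fun x => Real.log (f x)) (g' := fun x => f' x / f x) (φ := μ) hst ?_ ?_
    (hμint.mono_set hsub) ?_
  · have h1 := hpos t ⟨hs.trans hst, htT⟩
    have h2 := hpos s ⟨hs, hst.trans htT⟩
    calc f t = Real.exp (Real.log (f t)) := (Real.exp_log h1).symm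
      _ ≤ Real.exp (Real.log (f s) + ∫ x in s..t, μ x) := Real.exp_le_exp.2 (by linarith)
      _ = _ := by rw [Real.exp_add, Real.exp_log h2]
  · exact ContinuousOn.log (fun x hx => ((hf x (hsub hx)).continuousWithinAt).mono hsub)
      fun x hx => (hpos x (hsub hx)).ne'
  · intro x hx
    have hx' := hsub (Ioo_subset_Icc_self hx)
    refine (((hf x hx').hasDerivAt ?_).log (hpos x hx').ne').hasDerivWithinAt
    exact Icc_mem_nhds (hs.trans_lt hx.1) (hx.2.trans_le htT)
  · intro x hx
    have hx' := hsub (Ioo_subset_Icc_self hx)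
    rw [div_le_iff₀ (hpos x hx')]
    exact hle x hx'

lemma eq_zero_of_posHom {R : Z → EReal} (hR0 : ∀ v : Z, 0 ≤ R v) (hRproper : ∃ v : Z, R v ≠ ⊤)
    (hRlsc : LowerSemicontinuous R)
    (hRhom : ∀ (v : Z) (l : ℝ), 0 < l → R (l • v) = (l : EReal) * R v) : R 0 = 0 := by
  refine le_antisymm ?_ (hR0 0)
  obtain ⟨v, hv⟩ := hRproper
  by_contra! h
  obtain ⟨e, he0, he⟩ := EReal.lt_iff_exists_real_btwn.1 h
  have hcont : Tendsto (fun l : ℝ => l • v) (nhdsWithin 0 (Ioi 0)) (nhds 0) := by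
    have : Tendsto (fun l : ℝ => l • v) (nhds 0) (nhds ((0:ℝ) • v)) := by
      exact Continuous.tendsto (by fun_prop) 0
    rw [zero_smul] at this
    exact this.mono_left nhdsWithin_le_nhds
  have hev := hcont.eventually (hRlsc 0 (e : EReal) he)
  have hlim : Tendsto (fun l : ℝ => l * (R v).toReal) (nhdsWithin 0 (Ioi 0)) (nhds 0) := by
    have : Tendsto (fun l : ℝ => l * (R v).toReal) (nhds 0) (nhds (0 * (R v).toReal)) :=
      Continuous.tendsto (by fun_prop) 0
    rw [zero_mul] at this
    exact this.mono_left nhdsWithin_le_nhds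
  have hev2 := hlim.eventually (gt_mem_nhds (EReal.coe_pos.1 he0))
  obtain ⟨l, ⟨h1, h2⟩, h3⟩ := ((hev.and hev2).and self_mem_nhdsWithin).exists
  rw [hRhom v l h3, ← EReal.coe_toReal hv (ne_bot_of_le_ne_bot (by simp) (hR0 v)),
    ← EReal.coe_mul] at h1
  exact lt_asymm (EReal.coe_lt_coe_iff.1 h1) h2

/-- A sandwich theorem: a functional dominated by `R + l‖ι ·‖` on the effective domain of a
sublinear `R ≥ 0` splits into an element of `∂R(0)` and a functional bounded by `l‖ι ·‖`. -/
lemma distVdual_le {R : Z → EReal} (hR0 : ∀ v : Z, 0 ≤ R v) (hR00 : R 0 = 0)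
    (hRconvex : ∀ x y : Z, ∀ a b : ℝ, 0 ≤ a → 0 ≤ b → a + b = 1 →
      R (a • x + b • y) ≤ (a : EReal) * R x + (b : EReal) * R y)
    (hRhom : ∀ (v : Z) (l : ℝ), 0 < l → R (l • v) = (l : EReal) * R v)
    (ι : Z →L[ℝ] V) (η : Z →L[ℝ] ℝ) {l : ℝ} (hl : 0 ≤ l)
    (h : ∀ y, R y ≠ ⊤ → η y ≤ (R y).toReal + l * ‖ι y‖) :
    distVdual ι η (subdiffE R 0) ≤ (l : EReal) := by
  have hcoe : ∀ y, R y ≠ ⊤ → ((R y).toReal : EReal) = R y := fun y hy =>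
    EReal.coe_toReal hy (ne_bot_of_le_ne_bot (by simp) (hR0 y))
  have hsm : ∀ (c : ℝ), 0 < c → ∀ y, R y ≠ ⊤ →
      R (c • y) ≠ ⊤ ∧ (R (c • y)).toReal = c * (R y).toReal := by
    intro c hc y hy
    rw [hRhom y c hc, ← hcoe y hy, ← EReal.coe_mul]
    exact ⟨EReal.coe_ne_top _, EReal.toReal_coe _⟩
  have hadd : ∀ x y, R x ≠ ⊤ → R y ≠ ⊤ →
      R (x + y) ≠ ⊤ ∧ (R (x + y)).toReal ≤ (R x).toReal + (R y).toReal := by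
    intro x y hx hy
    have h2 := hRconvex ((2:ℝ) • x) ((2:ℝ) • y) (1/2) (1/2) (by norm_num) (by norm_num)
      (by norm_num)
    obtain ⟨a1, a2⟩ := hsm 2 two_pos x hx
    obtain ⟨b1, b2⟩ := hsm 2 two_pos y hy
    rw [smul_smul, smul_smul, ← hcoe _ a1, ← hcoe _ b1, a2, b2, ← EReal.coe_mul,
      ← EReal.coe_mul, ← EReal.coe_add,
      show (1/2 : ℝ) * (2 * (R x).toReal) + 1/2 * (2 * (R y).toReal)
        = (R x).toReal + (R y).toReal by ring,
      show (1/2 : ℝ) * 2 = 1 by norm_num, one_smul, one_smul] at h2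
    have hne : R (x + y) ≠ ⊤ := by
      intro h3; rw [h3] at h2
      exact EReal.coe_ne_top _ (top_le_iff.1 h2)
    refine ⟨hne, ?_⟩
    rwa [← hcoe _ hne, EReal.coe_le_coe_iff] at h2
  let D := {y : Z // R y ≠ ⊤}
  let F : Z → D → ℝ := fun x y => l * ‖ι (x + y)‖ + (R y).toReal - η y
  have : Nonempty D := ⟨⟨0, by simp [hR00]⟩⟩
  have hFlow : ∀ x y, -(l * ‖ι x‖) ≤ F x y := by
    intro x y
    have h1 := h y y.2
    have h2 : ‖ι (y : Z)‖ ≤ ‖ι (x + y)‖ + ‖ι x‖ := by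
      have := norm_sub_le (ι (x + y)) (ι x)
      simpa using this
    have h3 := mul_le_mul_of_nonneg_left h2 hl
    simp only [F]
    linarith
  have hbdd : ∀ x, BddBelow (range (F x)) := fun x =>
    ⟨_, by rintro _ ⟨y, rfl⟩; exact hFlow x y⟩
  have hNle : ∀ x (y : D), (⨅ y, F x y) ≤ F x y := fun x y => ciInf_le (hbdd x) y
  have hhom1 : ∀ c : ℝ, 0 < c → ∀ x, (⨅ y, F (c • x) y) ≤ c * ⨅ y, F x y := by
    intro c hc x
    rw [← div_le_iff₀' hc]
    refine le_ciInf fun y => ?_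
    rw [div_le_iff₀' hc]
    refine (hNle _ ⟨c • (y : Z), (hsm c hc y y.2).1⟩).trans (le_of_eq ?_)
    simp only [F]
    rw [← smul_add, map_smul, norm_smul, Real.norm_of_nonneg hc.le, (hsm c hc y y.2).2, map_smul,
      smul_eq_mul]
    ring
  have hNhom : ∀ c : ℝ, 0 < c → ∀ x, (⨅ y, F (c • x) y) = c * ⨅ y, F x y := by
    intro c hc x
    refine le_antisymm (hhom1 c hc x) ?_
    have := hhom1 c⁻¹ (inv_pos.2 hc) (c • x)
    rw [inv_smul_smul₀ hc.ne', ← div_eq_inv_mul, le_div_iff₀' hc] at this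
    exact this
  have hNadd : ∀ x x', (⨅ y, F (x + x') y) ≤ (⨅ y, F x y) + ⨅ y, F x' y := by
    intro x x'
    refine le_ciInf_add_ciInf fun y y' => ?_
    obtain ⟨h1, h2⟩ := hadd y y' y.2 y'.2
    refine (hNle _ ⟨_, h1⟩).trans ?_
    have h3 : ‖ι (x + x' + (y + y'))‖ ≤ ‖ι (x + y)‖ + ‖ι (x' + y')‖ := by
      rw [add_add_add_comm, map_add]; exact norm_add_le _ _
    have h4 := mul_le_mul_of_nonneg_left h3 hl
    simp only [F, map_add] at h4 ⊢
    linarith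
  obtain ⟨ξ, -, hξ⟩ := exists_extension_of_le_sublinear (⟨⊥, 0⟩ : Z →ₗ.[ℝ] ℝ)
    (fun x => ⨅ y, F x y) hNhom hNadd (by
      rintro ⟨x, hx⟩
      obtain rfl : x = 0 := by simpa using hx
      refine le_ciInf fun y => ?_
      simpa using hFlow 0 y)
  have hξι : ∀ x, ξ x ≤ l * ‖ι x‖ := fun x =>
    (hξ x).trans ((hNle x ⟨0, by simp [hR00]⟩).trans (by simp [F, hR00]))
  have habs : ∀ x, |ξ x| ≤ l * ‖ι x‖ := fun x =>
    abs_le.2 ⟨by have := hξι (-x); simp at this; linarith, hξι x⟩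
  let ξc : Z →L[ℝ] ℝ := ξ.mkContinuous (l * ‖ι‖) fun x => by
    rw [mul_assoc]
    exact (habs x).trans (mul_le_mul_of_nonneg_left (ι.le_opNorm x) hl)
  have hξc : ∀ x, ξc x = ξ x := fun x => rfl
  refine (sInf_le (a := ((VdualNorm ι ξc : ℝ) : EReal)) ?_).trans ?_
  · refine ⟨η - ξc, ?_, ⟨l, fun x => ?_⟩, ?_⟩
    · intro y
      by_cases hy : R y = ⊤
      · rw [hy]; exact le_top
      · have h1 := (hξ (-y)).trans (hNle _ ⟨y, hy⟩)
        simp [F] at h1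
        rw [hR00, zero_add, ← hcoe y hy, EReal.coe_le_coe_iff, sub_zero]
        simp [hξc]
        linarith
    · simpa [hξc] using habs x
    · simp
  · rw [EReal.coe_le_coe_iff]
    refine csSup_le ⟨0, 0, by simp, by simp⟩ ?_
    rintro _ ⟨x, hx, rfl⟩
    exact (hξι x).trans (mul_le_of_le_one_right hl hx)

/-- The multiplier of the constraint `‖ι ·‖ ≤ τ` in a stationarity inclusion. -/
lemma exists_multiplier {R : Z → EReal} (hR0 : ∀ v : Z, 0 ≤ R v) (hR00 : R 0 = 0)
    (hRhom : ∀ (v : Z) (l : ℝ), 0 < l → R (l • v) = (l : EReal) * R v)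
    {ι : Z →L[ℝ] V} (hinj : Function.Injective ι) {τ : ℝ} (hτ : 0 < τ)
    {η : Z →L[ℝ] ℝ} {v : Z} (hη : η ∈ subdiffE (fun v => R v + indic ι τ v) v) :
    R v ≠ ⊤ ∧ ‖ι v‖ ≤ τ ∧ ∃ l : ℝ, 0 ≤ l ∧ η v = (R v).toReal + l * τ ∧
      ∀ y, R y ≠ ⊤ → η y ≤ (R y).toReal + l * ‖ι y‖ := by
  have hcoe : ∀ y, R y ≠ ⊤ → ((R y).toReal : EReal) = R y := fun y hy =>
    EReal.coe_toReal hy (ne_bot_of_le_ne_bot (by simp) (hR0 y))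
  have h0 : R v + indic ι τ v + ((η (0 - v) : ℝ) : EReal) ≤ R 0 + indic ι τ 0 := hη 0
  have hi0 : indic ι τ 0 = 0 := by simp [indic, hτ.le]
  rw [hR00, hi0, zero_add] at h0
  have hRv : R v ≠ ⊤ := by
    intro h
    have : indic ι τ v ≠ ⊥ := by unfold indic; split_ifs <;> simp
    rw [h, EReal.top_add_of_ne_bot this, EReal.top_add_of_ne_bot (EReal.coe_ne_bot _)] at h0
    simp at h0
  have hv : ‖ι v‖ ≤ τ := by
    by_contra h
    rw [indic, if_neg h, EReal.add_top_of_ne_bot (ne_bot_of_le_ne_bot (by simp) (hR0 v)),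
      EReal.top_add_of_ne_bot (EReal.coe_ne_bot _)] at h0
    simp at h0
  have hball : ∀ y, ‖ι y‖ ≤ τ → R y ≠ ⊤ → η y - (R y).toReal ≤ η v - (R v).toReal := by
    intro y hy hRy
    have h1 : R v + indic ι τ v + ((η (y - v) : ℝ) : EReal) ≤ R y + indic ι τ y := hη y
    rw [indic, if_pos hv, indic, if_pos hy, add_zero, add_zero, ← hcoe v hRv, ← hcoe y hRy,
      ← EReal.coe_add, EReal.coe_le_coe_iff, map_sub] at h1
    linarith
  have hnn := hball 0 (by simp [hτ.le]) (by simp [hR00])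
  simp [hR00] at hnn
  refine ⟨hRv, hv, (η v - (R v).toReal) / τ, div_nonneg (sub_nonneg.2 hnn) hτ.le, ?_, ?_⟩
  · field_simp; ring
  intro y hRy
  rcases eq_or_ne (ι y) 0 with hy | hy
  · obtain rfl : y = 0 := hinj (by simpa using hy)
    simp [hR00]
  have hpos : 0 < ‖ι y‖ := norm_pos_iff.2 hy
  have hc : 0 < τ / ‖ι y‖ := div_pos hτ hpos
  have hsc : R ((τ / ‖ι y‖) • y) = ((τ / ‖ι y‖ * (R y).toReal : ℝ) : EReal) := by
    rw [hRhom y _ hc, EReal.coe_mul, hcoe y hRy]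
  have h1 := hball ((τ / ‖ι y‖) • y) ?_ (by rw [hsc]; exact EReal.coe_ne_top _)
  · rw [hsc, EReal.toReal_coe, map_smul, smul_eq_mul, ← mul_sub, div_mul_eq_mul_div,
      div_le_iff₀ hpos] at h1
    rw [div_mul_eq_mul_div, ← sub_le_iff_le_add', le_div_iff₀ hτ]
    linarith
  · rw [map_smul, norm_smul, Real.norm_of_nonneg hc.le, div_mul_cancel₀ _ hpos.ne']

/-- A discrete Gronwall estimate for an energy `e` that drops to `a` at the cost `r` and is then
amplified by a factor `exp (M (k + 1) - M k)`. -/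
lemma discrete_energy_estimate {e a r M : ℕ → ℝ} {m : ℝ} {n : ℕ} (hM0 : M 0 = 0)
    (hM : ∀ k < n, M k ≤ m) (hr : ∀ k, 0 ≤ r k) (ha : ∀ k < n, 0 ≤ a k)
    (hdrop : ∀ k < n, a k + r k ≤ e k)
    (hgrow : ∀ k, k + 1 < n → e (k + 1) ≤ a k * Real.exp (M (k + 1) - M k)) :
    ∀ k < n, a k + ∑ i ∈ Finset.range (k + 1), r i ≤ Real.exp m * e 0 := by
  have hexp : ∀ k < n, Real.exp (-m) ≤ Real.exp (-M k) := fun k hk =>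
    Real.exp_le_exp.2 (by have := hM k hk; linarith)
  have hdrop' : ∀ k < n, Real.exp (-M k) * a k + Real.exp (-m) * r k
      ≤ Real.exp (-M k) * e k := fun k hk => by
    have h1 := mul_le_mul_of_nonneg_left (hdrop k hk) (Real.exp_pos (-M k)).le
    have h2 := mul_le_mul_of_nonneg_right (hexp k hk) (hr k)
    rw [mul_add] at h1
    linarith
  have hind : ∀ k < n, Real.exp (-M k) * e k + Real.exp (-m) * ∑ i ∈ Finset.range k, r i
      ≤ e 0 := by
    intro k
    induction k with
    | zero => simp [hM0]
    | succ k ih =>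
      intro hk
      have h1 := ih (by omega)
      have h2 := hdrop' k (by omega)
      have h3 := mul_le_mul_of_nonneg_left (hgrow k hk) (Real.exp_pos (-M (k + 1))).le
      have h4 : Real.exp (-M (k + 1)) * (a k * Real.exp (M (k + 1) - M k))
          = Real.exp (-M k) * a k := by
        rw [mul_left_comm, ← Real.exp_add, mul_comm]
        congr 2; ring
      rw [Finset.sum_range_succ, mul_add]
      linarith
  intro k hk
  have h1 := hind k hk
  have h2 := hdrop' k hk
  have h3 := mul_le_mul_of_nonneg_right (hexp k hk) (ha k hk)
  rw [Finset.sum_range_succ]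
  have h4 : Real.exp (-m) * (a k + (∑ i ∈ Finset.range k, r i + r k)) ≤ e 0 := by
    rw [mul_add, mul_add]; linarith
  have h5 := mul_le_mul_of_nonneg_left h4 (Real.exp_pos m).le
  rwa [← mul_assoc, ← Real.exp_add, add_neg_cancel, Real.exp_zero, one_mul] at h5

/-- Absorption of the lower-order terms in the one-step estimate. -/
lemma step_absorb {α c C D K ε τ a b x Δ l l' : ℝ} (hα : 0 < α) (hc : 0 ≤ c)
    (hε0 : 0 ≤ ε) (hε : c * K * ε ≤ α / 2) (hD : 0 ≤ D) (hx : 0 ≤ x) (ha : 0 ≤ a) (hb : 0 ≤ b)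
    (hbK : b ≤ K * a) (hbτ : b ≤ τ) (hbx : b ≤ ε * a + D * x) (hΔ0 : 0 ≤ Δ) (hΔτ : Δ ≤ τ)
    (h : α * a ^ 2 - c * b ^ 2 + τ * (l' - l) ≤ C * Δ * a) :
    α / 4 * a ^ 2 + τ * (l' - l) ≤ τ * (c * D * x + C ^ 2 / α * Δ) := by
  have h1 : c * b ^ 2 ≤ α / 2 * a ^ 2 + τ * (c * D * x) := by
    have e1 : c * b * b ≤ c * b * (ε * a + D * x) :=
      mul_le_mul_of_nonneg_left hbx (mul_nonneg hc hb)
    have e2 : c * ε * a * b ≤ c * ε * a * (K * a) :=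
      mul_le_mul_of_nonneg_left hbK (by positivity)
    have e3 : c * D * x * b ≤ c * D * x * τ := mul_le_mul_of_nonneg_left hbτ (by positivity)
    have e4 : c * K * ε * a ^ 2 ≤ α / 2 * a ^ 2 := mul_le_mul_of_nonneg_right hε (sq_nonneg a)
    nlinarith
  have h2 : C * Δ * a ≤ α / 4 * a ^ 2 + C ^ 2 / α * Δ ^ 2 := by
    have e : α / 4 * a ^ 2 + C ^ 2 / α * Δ ^ 2 - C * Δ * a = (α * a / 2 - C * Δ) ^ 2 / α := by
      field_simp; ring
    have : 0 ≤ (α * a / 2 - C * Δ) ^ 2 / α := by positivity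
    linarith
  have h3 : C ^ 2 / α * Δ ^ 2 ≤ C ^ 2 / α * (τ * Δ) := by
    refine mul_le_mul_of_nonneg_left ?_ (by positivity)
    nlinarith
  linarith

/-- **A-priori estimates and finite termination for the local stationarity scheme (LISS).**
Under the standing assumptions on the spaces `Z ↪c,d V`, `V ↪ X`, the energy `I`
(regularity, coercivity, time-derivative bound, Gårding-like inequality, time-Lipschitz
estimate) and the dissipation `R` (proper, convex, lsc, positively 1-homogeneous,
`κ‖·‖_X`-bounded from below), with locally stable initial datum `z₀`, there are constants
`C₁, C₂, C₃ > 0` independent of `τ` such that for every `τ ∈ (0,T]` and every sequence of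
iterates of the scheme there is a finite index `N` with `t_N ≥ T`,
`Σ_{i=1}^N ‖z_i − z_{i−1}‖_V ≤ C₁`, `Σ_{i=1}^N ‖z_i − z_{i−1}‖_Z² ≤ C₂τ`, and
`dist_{V*}(−D_zI(t_{k−1},z_k), ∂R(0)) ≤ C₃` for `k = 1,…,N`. -/
theorem stmt16
    {X : Type*} [NormedAddCommGroup X] [NormedSpace ℝ X]
    [CompleteSpace Z] [CompleteSpace V] [CompleteSpace X]
    [TopologicalSpace.SeparableSpace Z]
    (hreflZ : Function.Surjective ⇑(NormedSpace.inclusionInDoubleDual ℝ Z))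
    (hreflV : Function.Surjective ⇑(NormedSpace.inclusionInDoubleDual ℝ V))
    (ι : Z →L[ℝ] V) (hinj : Function.Injective ι) (hdense : DenseRange ι)
    (hcompact : ∀ s : Set Z, Bornology.IsBounded s → IsCompact (closure (ι '' s)))
    (ιX : V →L[ℝ] X) (hinjX : Function.Injective ιX)
    (T : ℝ) (hT : 0 < T)
    (I : ℝ → Z → ℝ) (dtI : ℝ → Z → ℝ) (DzI : ℝ → Z → (Z →L[ℝ] ℝ))
    (hI_t : ∀ z : Z, ∀ t ∈ Icc (0:ℝ) T,
      HasDerivWithinAt (fun s => I s z) (dtI t z) (Icc 0 T) t)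
    (hI_z : ∀ t ∈ Icc (0:ℝ) T, ∀ z : Z, HasFDerivAt (fun y => I t y) (DzI t z) z)
    (hI_cont : ContinuousOn (fun p : ℝ × Z => (I p.1 p.2, dtI p.1 p.2, DzI p.1 p.2))
      (Icc (0:ℝ) T ×ˢ univ))
    (c₀ c₁ : ℝ) (hc₀ : 0 < c₀) (hc₁ : 0 < c₁)
    (hcoerc : ∀ t ∈ Icc (0:ℝ) T, ∀ z : Z, c₁ * ‖z‖ - c₀ ≤ I t z)
    (β : ℝ) (hβ : 0 < β)
    (μ : ℝ → ℝ) (hμint : MeasureTheory.IntegrableOn μ (Icc 0 T))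
    (hμ0 : ∀ t ∈ Icc (0:ℝ) T, 0 ≤ μ t)
    (hdtI : ∀ t ∈ Icc (0:ℝ) T, ∀ z : Z, |dtI t z| ≤ μ t * (I t z + β))
    (α : ℝ) (hα : 0 < α)
    (hGarding : ∀ ρ : ℝ, 0 < ρ → ∃ c : ℝ, 0 ≤ c ∧ ∀ t ∈ Icc (0:ℝ) T, ∀ z₁ z₂ : Z,
      ‖z₁‖ ≤ ρ → ‖z₂‖ ≤ ρ →
      α * ‖z₁ - z₂‖ ^ 2 - c * ‖ι (z₁ - z₂)‖ ^ 2 ≤ (DzI t z₁ - DzI t z₂) (z₁ - z₂))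
    (htLip : ∀ ρ : ℝ, 0 < ρ → ∃ C : ℝ, 0 ≤ C ∧ ∀ t ∈ Icc (0:ℝ) T, ∀ s ∈ Icc (0:ℝ) T,
      ∀ z : Z, ‖z‖ ≤ ρ → ∀ v : Z, (DzI t z - DzI s z) v ≤ C * |t - s| * ‖v‖)
    (R : Z → EReal) (hR0 : ∀ v : Z, 0 ≤ R v) (hRproper : ∃ v : Z, R v ≠ ⊤)
    (hRconvex : ∀ x y : Z, ∀ a b : ℝ, 0 ≤ a → 0 ≤ b → a + b = 1 →
      R (a • x + b • y) ≤ (a : EReal) * R x + (b : EReal) * R y)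
    (hRlsc : LowerSemicontinuous R)
    (hRhom : ∀ (v : Z) (l : ℝ), 0 < l → R (l • v) = (l : EReal) * R v)
    (κ : ℝ) (hκ : 0 < κ)
    (hRlow : ∀ v : Z, ((κ * ‖ιX (ι v)‖ : ℝ) : EReal) ≤ R v)
    (z₀ : Z) (hstab0 : -DzI 0 z₀ ∈ subdiffE R 0) :
    ∃ C₁ C₂ C₃ : ℝ, 0 < C₁ ∧ 0 < C₂ ∧ 0 < C₃ ∧
      ∀ τ : ℝ, 0 < τ → τ ≤ T →
      ∀ (z : ℕ → Z) (t : ℕ → ℝ), z 0 = z₀ → t 0 = 0 →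
      (∀ k : ℕ, -DzI (t k) (z (k + 1)) ∈
        subdiffE (fun v => R v + indic ι τ v) (z (k + 1) - z k)) →
      (∀ k : ℕ, ((I (t k) (z (k + 1)) : ℝ) : EReal) + R (z (k + 1) - z k)
        ≤ ((I (t k) (z k) : ℝ) : EReal)) →
      (∀ k : ℕ, t (k + 1) = t k + τ - ‖ι (z (k + 1) - z k)‖) →
      ∃ N : ℕ, T ≤ t N ∧
        (∑ i ∈ Finset.range N, ‖ι (z (i + 1) - z i)‖) ≤ C₁ ∧
        (∑ i ∈ Finset.range N, ‖z (i + 1) - z i‖ ^ 2) ≤ C₂ * τ ∧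
        ∀ k < N, distVdual ι (-DzI (t k) (z (k + 1))) (subdiffE R 0)
          ≤ ((C₃ : ℝ) : EReal) := by
  have hR00 : R 0 = 0 := eq_zero_of_posHom hR0 hRproper hRlsc hRhom
  set B : ℝ := β + c₀ with hB
  set M : ℝ → ℝ := fun s => ∫ x in (0:ℝ)..s, μ x with hM
  have hIpos : ∀ s ∈ Icc (0:ℝ) T, ∀ y, c₁ * ‖y‖ + β ≤ I s y + B := fun s hs y => by
    have := hcoerc s hs y
    simp only [hB]; linarith
  have hIpos' : ∀ s ∈ Icc (0:ℝ) T, ∀ y, 0 < I s y + B := fun s hs y =>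
    (by positivity : 0 < c₁ * ‖y‖ + β).trans_le (hIpos s hs y)
  have hgron : ∀ y s s', 0 ≤ s → s ≤ s' → s' ≤ T →
      I s' y + B ≤ (I s y + B) * Real.exp (M s' - M s) := fun y s s' h0 h1 h2 =>
    le_mul_exp_integral (f := fun s => I s y + B) (f' := fun s => dtI s y)
      (fun t ht => (hI_t y t ht).add_const B) (fun t ht => hIpos' t ht y) hμint
      (fun t ht => by
        have e1 := (le_abs_self _).trans (hdtI t ht y)
        have e2 := mul_nonneg (hμ0 t ht) hc₀.le
        simp only [hB]; nlinarith) h0 h1 h2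
  have hMmono : ∀ s, 0 ≤ s → s ≤ T → M s ≤ M T := fun s h0 h1 => by
    refine intervalIntegral.integral_mono_interval le_rfl h0 h1 ?_
      ((intervalIntegrable_iff_integrableOn_Icc_of_le hT.le).2 hμint)
    filter_upwards [MeasureTheory.ae_restrict_mem measurableSet_Ioc] with x hx
    exact hμ0 x (Ioc_subset_Icc_self hx)
  have hT0 : (0:ℝ) ∈ Icc (0:ℝ) T := ⟨le_rfl, hT.le⟩
  set E : ℝ := Real.exp (M T) * (I 0 z₀ + B) with hE
  have hEpos : 0 < E := mul_pos (Real.exp_pos _) (hIpos' 0 hT0 z₀)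
  have hE0 : I 0 z₀ + B ≤ E := by
    refine le_mul_of_one_le_left (hIpos' 0 hT0 z₀).le (Real.one_le_exp ?_)
    simpa [hM] using hMmono 0 le_rfl hT.le
  set ρ : ℝ := E / c₁ with hρ
  have hρpos : 0 < ρ := div_pos hEpos hc₁
  have hbound : ∀ s ∈ Icc (0:ℝ) T, ∀ y, I s y + B ≤ E → ‖y‖ ≤ ρ := fun s hs y h => by
    rw [hρ, le_div_iff₀ hc₁]
    have := hIpos s hs y
    linarith
  obtain ⟨c, hc, hG⟩ := hGarding ρ hρpos
  obtain ⟨C, hC, hL⟩ := htLip ρ hρpos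
  set K : ℝ := ‖ι‖ with hK
  have hK0 : 0 ≤ K := norm_nonneg ι
  set ε : ℝ := α / (2 * (c * K + 1)) with hε
  have hcK : 0 ≤ c * K := mul_nonneg hc hK0
  have hεpos : 0 < ε := by positivity
  have hεle : c * K * ε ≤ α / 2 := by
    rw [hε, mul_div_assoc', div_le_div_iff₀ (by positivity) two_pos]
    nlinarith
  obtain ⟨D, hD, hEhr⟩ := ehrling ι hcompact ιX hinjX hεpos
  set Q : ℝ := c * D * (E / κ) + C ^ 2 / α * T + 1 with hQ
  have hQpos : 0 < Q := by positivity
  set C₂ : ℝ := 4 / α * Q with hC₂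
  have hC₂pos : 0 < C₂ := by positivity
  refine ⟨K ^ 2 * C₂ + 2 * T, C₂, Q, by positivity, hC₂pos, hQpos, ?_⟩
  intro τ hτ hτT z t hz0 ht0 hstat hen htk
  have hmul := fun k => exists_multiplier hR0 hR00 hRhom hinj hτ (hstat k)
  choose hRv hvτ l hl0 hlv hly using hmul
  set r : ℕ → ℝ := fun k => (R (z (k + 1) - z k)).toReal with hr
  have hRr : ∀ k, R (z (k + 1) - z k) = (r k : EReal) := fun k =>
    (EReal.coe_toReal (hRv k) (ne_bot_of_le_ne_bot (by simp) (hR0 _))).symm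
  have hr0 : ∀ k, 0 ≤ r k := fun k => EReal.toReal_nonneg (hR0 _)
  have hen' : ∀ k, I (t k) (z (k + 1)) + r k ≤ I (t k) (z k) := fun k => by
    have := hen k
    rw [hRr, ← EReal.coe_add, EReal.coe_le_coe_iff] at this
    exact this
  have hmono : Monotone t := monotone_nat_of_le_succ fun k => by
    have := hvτ k
    rw [htk k]; linarith
  have ht0' : ∀ k, 0 ≤ t k := fun k => ht0 ▸ hmono (Nat.zero_le k)
  have hΔτ : ∀ k, t k - t (k - 1) ≤ τ := fun k => by
    cases k with
    | zero => simp [hτ.le]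
    | succ k =>
      have := norm_nonneg (ι (z (k + 1) - z k))
      rw [Nat.add_sub_cancel, htk k]; linarith
  set l' : ℕ → ℝ := fun k => Nat.casesOn k 0 l with hl'
  have hl'0 : ∀ k, 0 ≤ l' k := fun k => by cases k; exacts [le_rfl, hl0 _]
  have hly' : ∀ k y, R y ≠ ⊤ →
      -DzI (t (k - 1)) (z k) y ≤ (R y).toReal + l' k * ‖ι y‖ := by
    intro k y hy
    cases k with
    | zero =>
      have h1 := hstab0 y
      rw [hR00, zero_add, sub_zero,
        ← EReal.coe_toReal hy (ne_bot_of_le_ne_bot (by simp) (hR0 y)),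
        EReal.coe_le_coe_iff] at h1
      simpa [hl', ht0, hz0] using h1
    | succ k => exact hly k y hy
  have hall : ∀ n, (∀ k < n, t k < T) →
      (∑ i ∈ Finset.range n, ‖ι (z (i + 1) - z i)‖) ≤ K ^ 2 * C₂ + 2 * T ∧
      (∑ i ∈ Finset.range n, ‖z (i + 1) - z i‖ ^ 2) ≤ C₂ * τ ∧ l' n ≤ Q := by
    intro n hn
    have htm : ∀ k < n, t k ∈ Icc (0:ℝ) T := fun k hk => ⟨ht0' k, (hn k hk).le⟩
    have htm' : ∀ k < n, t (k - 1) ∈ Icc (0:ℝ) T := fun k hk => htm _ (by omega)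
    have hen2 := discrete_energy_estimate (e := fun k => I (t k) (z k) + B)
      (a := fun k => I (t k) (z (k + 1)) + B) (r := r) (M := fun k => M (t k)) (m := M T) (n := n)
      (by simp [hM, ht0]) (fun k hk => hMmono _ (htm k hk).1 (htm k hk).2) hr0
      (fun k hk => (hIpos' _ (htm k hk) _).le) (fun k _ => by have := hen' k; linarith)
      (fun k hk => hgron _ _ _ (ht0' k) (hmono (Nat.le_succ k)) (htm _ hk).2)
    simp only [ht0, hz0] at hen2
    have hzρ : ∀ k ≤ n, ‖z k‖ ≤ ρ := by
      intro k hk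
      cases k with
      | zero => rw [hz0]; exact hbound 0 hT0 z₀ hE0
      | succ k =>
        refine hbound _ (htm k hk) _ ?_
        have h1 := hen2 k hk
        have h2 := Finset.sum_nonneg fun i (_ : i ∈ Finset.range (k + 1)) => hr0 i
        linarith
    have hsumr : ∑ i ∈ Finset.range n, r i ≤ E := by
      cases n with
      | zero => simpa using hEpos.le
      | succ n =>
        have h1 := hen2 n n.lt_succ_self
        have h2 := hIpos' _ (htm n n.lt_succ_self) (z (n + 1))
        linarith
    have hstep : ∀ k < n, α / 4 * ‖z (k + 1) - z k‖ ^ 2 + τ * (l' (k + 1) - l' k)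
        ≤ τ * (c * D * (r k / κ) + C ^ 2 / α * (t k - t (k - 1))) := by
      intro k hk
      have hx : ‖ιX (ι (z (k + 1) - z k))‖ ≤ r k / κ := by
        have := hRlow (z (k + 1) - z k)
        rw [hRr, EReal.coe_le_coe_iff] at this
        rw [le_div_iff₀ hκ]; linarith
      have hΔ0 : 0 ≤ t k - t (k - 1) := sub_nonneg.2 (hmono (Nat.sub_le k 1))
      refine step_absorb hα hc hεpos.le hεle hD (div_nonneg (hr0 k) hκ.le) (norm_nonneg _)
        (norm_nonneg (ι (z (k + 1) - z k))) (ι.le_opNorm _) (hvτ k)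
        ((hEhr _).trans (add_le_add_right (mul_le_mul_of_nonneg_left hx hD) _))
        hΔ0 (hΔτ k) ?_
      have h1 := hG (t k) (htm k hk) (z (k + 1)) (z k) (hzρ _ hk) (hzρ _ hk.le)
      have h2 := hL (t (k - 1)) (htm' k hk) (t k) (htm k hk) (z k) (hzρ _ hk.le)
        (z (k + 1) - z k)
      rw [abs_sub_comm, abs_of_nonneg hΔ0] at h2
      have h3 := hly' k _ (hRv k)
      have h4 := hlv k
      have h5 := mul_le_mul_of_nonneg_left (hvτ k) (hl'0 k)
      simp only [sub_apply, neg_apply] at h1 h2 h4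
      have h6 : l' (k + 1) = l k := rfl
      rw [h6]
      linarith
    have hsum := Finset.sum_le_sum fun k (hk : k ∈ Finset.range n) =>
      hstep k (Finset.mem_range.1 hk)
    have htel : ∑ k ∈ Finset.range n, (t k - t (k - 1)) ≤ T := by
      cases n with
      | zero => simpa using hT.le
      | succ n =>
        rw [Finset.sum_range_succ']
        simp only [Nat.add_sub_cancel, Nat.zero_sub, sub_self, add_zero, Finset.sum_range_sub, ht0,
          sub_zero]
        exact (hn n n.lt_succ_self).le
    have hl'z : l' 0 = 0 := rfl
    rw [Finset.sum_add_distrib, ← Finset.mul_sum, ← Finset.mul_sum, ← Finset.mul_sum,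
      Finset.sum_range_sub, hl'z, sub_zero, Finset.sum_add_distrib, ← Finset.mul_sum,
      ← Finset.mul_sum, ← Finset.sum_div] at hsum
    have hQ1 : c * D * ((∑ i ∈ Finset.range n, r i) / κ)
        + C ^ 2 / α * ∑ k ∈ Finset.range n, (t k - t (k - 1)) ≤ Q := by
      have h1 : c * D * ((∑ i ∈ Finset.range n, r i) / κ) ≤ c * D * (E / κ) := by gcongr
      have h2 : C ^ 2 / α * ∑ k ∈ Finset.range n, (t k - t (k - 1)) ≤ C ^ 2 / α * T := by
        gcongr
      linarith
    have hτQ := hsum.trans (mul_le_mul_of_nonneg_left hQ1 hτ.le)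
    have hS2 : 0 ≤ ∑ i ∈ Finset.range n, ‖z (i + 1) - z i‖ ^ 2 := by positivity
    have hτl := mul_nonneg hτ.le (hl'0 n)
    have hsq : (∑ i ∈ Finset.range n, ‖z (i + 1) - z i‖ ^ 2) ≤ C₂ * τ := by
      have h1 : α / 4 * ∑ i ∈ Finset.range n, ‖z (i + 1) - z i‖ ^ 2 ≤ τ * Q := by linarith
      rw [hC₂, div_mul_eq_mul_div, div_mul_eq_mul_div, le_div_iff₀ hα]
      linarith
    refine ⟨?_, hsq, ?_⟩
    · have htn : t n = n * τ - ∑ i ∈ Finset.range n, ‖ι (z (i + 1) - z i)‖ := by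
        have h1 := Finset.sum_range_sub t n
        rw [ht0, sub_zero] at h1
        rw [← h1, Finset.sum_congr rfl fun k _ => show t (k + 1) - t k
          = τ - ‖ι (z (k + 1) - z k)‖ by rw [htk k]; ring]
        simp
      have htn2 : t n ≤ 2 * T := by
        cases n with
        | zero => rw [ht0]; positivity
        | succ n =>
          have h1 := hn n n.lt_succ_self
          have h2 := norm_nonneg (ι (z (n + 1) - z n))
          rw [htk n]; linarith
      have hyoung : ∀ k, ‖ι (z (k + 1) - z k)‖
          ≤ K ^ 2 / (2 * τ) * ‖z (k + 1) - z k‖ ^ 2 + τ / 2 := by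
        intro k
        refine (ι.le_opNorm _).trans ?_
        rw [← hK, ← sub_nonneg, show K ^ 2 / (2 * τ) * ‖z (k + 1) - z k‖ ^ 2 + τ / 2
          - K * ‖z (k + 1) - z k‖ = (K * ‖z (k + 1) - z k‖ - τ) ^ 2 / (2 * τ) by
            field_simp; ring]
        positivity
      have h1 := Finset.sum_le_sum fun k (_ : k ∈ Finset.range n) => hyoung k
      rw [Finset.sum_add_distrib, ← Finset.mul_sum, Finset.sum_const, Finset.card_range,
        nsmul_eq_mul] at h1
      have h2 : K ^ 2 / (2 * τ) * ∑ i ∈ Finset.range n, ‖z (i + 1) - z i‖ ^ 2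
          ≤ K ^ 2 * C₂ / 2 := by
        refine (mul_le_mul_of_nonneg_left hsq (by positivity)).trans (le_of_eq ?_)
        field_simp
      linarith
    · refine le_of_mul_le_mul_left ?_ hτ
      have : 0 ≤ α / 4 * ∑ i ∈ Finset.range n, ‖z (i + 1) - z i‖ ^ 2 := by positivity
      linarith
  have hex : ∃ n, T ≤ t n := by
    by_contra! hlt
    obtain ⟨n, hn⟩ := exists_nat_gt ((T + (K ^ 2 * C₂ + 2 * T)) / τ)
    rw [div_lt_iff₀ hτ] at hn
    have h1 := Finset.sum_range_sub t n
    rw [ht0, sub_zero, Finset.sum_congr rfl fun k _ => show t (k + 1) - t k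
      = τ - ‖ι (z (k + 1) - z k)‖ by rw [htk k]; ring] at h1
    simp only [Finset.sum_sub_distrib, Finset.sum_const, Finset.card_range, nsmul_eq_mul] at h1
    have h2 := (hall n fun k _ => hlt k).1
    have h3 := hlt n
    linarith
  classical
  have hfind : ∀ k < Nat.find hex, t k < T := fun k hk => not_le.1 (Nat.find_min hex hk)
  obtain ⟨h1, h2, -⟩ := hall _ hfind
  refine ⟨Nat.find hex, Nat.find_spec hex, h1, h2, fun k hk => ?_⟩
  refine (distVdual_le hR0 hR00 hRconvex hRhom ι _ (hl0 k) (hly k)).trans ?_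
  exact EReal.coe_le_coe_iff.2 (hall (k + 1) fun j hj => hfind j (by omega)).2.2
end
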